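/- The set Y_f^p = {y ∈ ℝ : L_f(y) is a perfect subset of ℝ (closed with no isolated points, hence uncountable)} is residual (comeagre) in the range [m(f), M(f)] of f, i.e., Y_f^p ∩ [m(f), M(f)] is a comeagre subset of the interval [m(f), M(f)] with its subspace topology. -/

import Mathlib

/-- `phi x` is the distance from `x` to the nearest integer. -/
noncomputable def phi (x : ℝ) : ℝ := |x - round x|

/-- The signed Takagi function associated to the sign sequence `r`. -/
noncomputable def takagi (r : ℕ → ℝ) (x : ℝ) : ℝ :=
  ∑' n : ℕ, r n / 2 ^ n * phi (2 ^ n * x)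

theorem phi_nonneg (x : ℝ) : 0 ≤ phi x := abs_nonneg _

theorem phi_le_half (x : ℝ) : phi x ≤ 1 / 2 := abs_sub_round x

theorem phi_eq_abs_sub {x : ℝ} {n : ℤ} (h : |x - n| ≤ 1 / 2) : phi x = |x - n| := by
  refine le_antisymm (round_le x n) ?_
  by_cases hn : round x = n
  · simp [phi, hn]
  · have h1 : (1 : ℝ) ≤ |((round x - n : ℤ) : ℝ)| := by
      exact_mod_cast Int.one_le_abs (sub_ne_zero.2 hn)
    have h2 : |((round x - n : ℤ) : ℝ)| ≤ |x - n| + phi x := by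
      have : ((round x - n : ℤ) : ℝ) = (x - n) - (x - round x) := by push_cast; ring
      rw [this]
      exact abs_sub _ _
    linarith

theorem phi_intCast (n : ℤ) : phi n = 0 := by simp [phi]

theorem continuous_phi : Continuous phi := by
  have : phi = fun x : ℝ => ‖(x : UnitAddCircle)‖ := by
    funext x
    rw [UnitAddCircle.norm_eq, phi]
  rw [this]
  exact continuous_norm.comp (AddCircle.continuous_mk' 1)

theorem phi_midpoint {z : ℤ} {s t : ℝ} (hs : s ∈ Set.Icc ((z : ℝ) / 2) ((z + 1) / 2))
    (ht : t ∈ Set.Icc ((z : ℝ) / 2) ((z + 1) / 2)) :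
    phi ((s + t) / 2) = (phi s + phi t) / 2 := by
  obtain ⟨hs1, hs2⟩ := hs
  obtain ⟨ht1, ht2⟩ := ht
  obtain ⟨w, rfl | rfl⟩ := Int.even_or_odd' z
  · have key : ∀ v : ℝ, ((2 * w : ℤ) : ℝ) / 2 ≤ v → v ≤ (((2 * w : ℤ) : ℝ) + 1) / 2 →
        phi v = v - w := by
      intro v h1 h2
      push_cast at h1 h2
      have h3 : |v - w| = v - w := abs_of_nonneg (by linarith)
      rw [phi_eq_abs_sub (n := w) (by rw [h3]; linarith), h3]
    rw [key s hs1 hs2, key t ht1 ht2, key _ (by linarith) (by linarith)]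
    ring
  · have key : ∀ v : ℝ, ((2 * w + 1 : ℤ) : ℝ) / 2 ≤ v → v ≤ (((2 * w + 1 : ℤ) : ℝ) + 1) / 2 →
        phi v = w + 1 - v := by
      intro v h1 h2
      push_cast at h1 h2
      have h3 : |v - ((w + 1 : ℤ) : ℝ)| = w + 1 - v := by
        rw [abs_of_nonpos (by push_cast; linarith)]
        push_cast
        ring
      rw [phi_eq_abs_sub (n := w + 1) (by rw [h3]; linarith), h3]
    rw [key s hs1 hs2, key t ht1 ht2, key _ (by linarith) (by linarith)]
    ring

theorem phi_two_pow_mul_midpoint {j n : ℕ} (hj : j < n) (k : ℤ) :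
    phi (2 ^ j * ((2 * k + 1) / 2 ^ (n + 1))) =
      (phi (2 ^ j * (k / 2 ^ n)) + phi (2 ^ j * ((k + 1) / 2 ^ n))) / 2 := by
  obtain ⟨i, rfl⟩ := Nat.exists_eq_add_of_lt hj
  set q : ℤ := 2 ^ i with hq
  have hq0 : 0 < q := by positivity
  have hqr : (q : ℝ) = 2 ^ i := by simp [hq]
  have hqr0 : (0 : ℝ) < q := by exact_mod_cast hq0
  have hs : (2 : ℝ) ^ j * (k / 2 ^ (j + i + 1)) = k / q / 2 := by
    rw [hqr]; field_simp; ring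
  have ht : (2 : ℝ) ^ j * ((k + 1) / 2 ^ (j + i + 1)) = (k + 1) / q / 2 := by
    rw [hqr]; field_simp; ring
  have hm : (2 : ℝ) ^ j * ((2 * k + 1) / 2 ^ (j + i + 1 + 1)) =
      ((k / q / 2 : ℝ) + (k + 1) / q / 2) / 2 := by
    rw [hqr]; field_simp; ring
  have h1 : ((k / q : ℤ) : ℝ) * q ≤ k := by exact_mod_cast Int.ediv_mul_le k hq0.ne'
  have h2 : (k : ℝ) + 1 ≤ (((k / q : ℤ) : ℝ) + 1) * q := by
    exact_mod_cast Int.add_one_le_of_lt (Int.lt_ediv_add_one_mul_self k hq0)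
  rw [hs, ht, hm]
  have h3 : ((k / q : ℤ) : ℝ) ≤ k / q := (le_div_iff₀ hqr0).2 h1
  have h4 : ((k : ℝ) + 1) / q ≤ ((k / q : ℤ) : ℝ) + 1 := (div_le_iff₀ hqr0).2 h2
  have h5 : (k : ℝ) / q ≤ (k + 1) / q := by gcongr; linarith
  apply phi_midpoint (z := k / q) <;> constructor <;> linarith

theorem continuous_takagi {r : ℕ → ℝ} (hr : ∀ n, r n = 1 ∨ r n = -1) :
    Continuous (takagi r) := by
  refine continuous_tsum (u := fun n : ℕ => ((1 : ℝ) / 2) ^ n)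
    (fun n => continuous_const.mul (continuous_phi.comp (continuous_const.mul continuous_id)))
    summable_geometric_two fun n x => ?_
  have h1 : |r n| = 1 := by rcases hr n with h | h <;> simp [h]
  have h2 : (0 : ℝ) < (1 / 2) ^ n := by positivity
  have h3 := phi_le_half (2 ^ n * x)
  rw [Real.norm_eq_abs, abs_mul, abs_div, h1, abs_of_nonneg (phi_nonneg _),
    abs_of_pos (by positivity : (0 : ℝ) < 2 ^ n), ← one_div_pow]
  nlinarith

theorem takagi_neg (r : ℕ → ℝ) : takagi (-r) = -takagi r := by
  funext x
  simp only [takagi, Pi.neg_apply, neg_div, neg_mul, tsum_neg]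

theorem takagi_dyadic (r : ℕ → ℝ) (n : ℕ) (k : ℤ) :
    takagi r (k / 2 ^ n) = ∑ j ∈ Finset.range n, r j / 2 ^ j * phi (2 ^ j * (k / 2 ^ n)) := by
  refine tsum_eq_sum fun j hj => ?_
  obtain ⟨i, rfl⟩ := Nat.exists_eq_add_of_le (not_lt.1 (Finset.mem_range.not.1 hj))
  have : (2 : ℝ) ^ (n + i) * (k / 2 ^ n) = ((2 ^ i * k : ℤ) : ℝ) := by
    push_cast
    field_simp
    ring
  rw [this, phi_intCast, mul_zero]

theorem takagi_midpoint (r : ℕ → ℝ) (n : ℕ) (k : ℤ) :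
    takagi r ((2 * k + 1) / 2 ^ (n + 1)) =
      (takagi r (k / 2 ^ n) + takagi r ((k + 1) / 2 ^ n)) / 2 + r n / 2 ^ (n + 1) := by
  have h1 := takagi_dyadic r (n + 1) (2 * k + 1)
  have h2 := takagi_dyadic r n (k + 1)
  push_cast at h1 h2
  have h3 : phi (2 ^ n * ((2 * k + 1) / 2 ^ (n + 1))) = 1 / 2 := by
    have h4 : (2 : ℝ) ^ n * ((2 * k + 1) / 2 ^ (n + 1)) - k = 1 / 2 := by
      field_simp
      ring
    rw [phi_eq_abs_sub (n := k) (by rw [h4]; norm_num), h4]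
    norm_num
  rw [h1, h2, takagi_dyadic, Finset.sum_range_succ, h3, ← Finset.sum_add_distrib,
    Finset.sum_div]
  congr 1
  · refine Finset.sum_congr rfl fun j hj => ?_
    rw [phi_two_pow_mul_midpoint (Finset.mem_range.1 hj)]
    ring
  · field_simp
    ring

theorem exists_dyadic_slope_eq_sub {r : ℕ → ℝ} (hr : ∀ n, r n = 1 ∨ r n = -1) (N : ℕ) :
    ∀ (n : ℕ) (k : ℤ), ∃ (n' : ℕ) (k' : ℤ), (k : ℝ) / 2 ^ n ≤ k' / 2 ^ n' ∧
      ((k' : ℝ) + 1) / 2 ^ n' ≤ (k + 1) / 2 ^ n ∧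
      2 ^ n' * (takagi r ((k' + 1) / 2 ^ n') - takagi r (k' / 2 ^ n')) =
        2 ^ n * (takagi r ((k + 1) / 2 ^ n) - takagi r (k / 2 ^ n)) - N := by
  induction N with
  | zero => exact fun n k => ⟨n, k, le_rfl, le_rfl, by simp⟩
  | succ N ih =>
    intro n k
    obtain ⟨n₁, k₁, hl, hu, h⟩ := ih n k
    have hmid := takagi_midpoint r n₁ k₁
    have hpow : (0 : ℝ) < 2 ^ n₁ := by positivity
    have hleft : (2 * k₁ : ℝ) / 2 ^ (n₁ + 1) = k₁ / 2 ^ n₁ := by field_simp; ring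
    have hright : (2 * k₁ + 1 + 1 : ℝ) / 2 ^ (n₁ + 1) = (k₁ + 1) / 2 ^ n₁ := by
      field_simp; ring
    have hle₁ : (2 * k₁ : ℝ) / 2 ^ (n₁ + 1) ≤ (2 * k₁ + 1) / 2 ^ (n₁ + 1) := by
      gcongr; linarith
    have hle₂ : (2 * k₁ + 1 : ℝ) / 2 ^ (n₁ + 1) ≤ (2 * k₁ + 1 + 1) / 2 ^ (n₁ + 1) := by
      gcongr; linarith
    rw [hleft] at hle₁
    rw [hright] at hle₂
    have hcancel : (2 : ℝ) ^ (n₁ + 1) * (r n₁ / 2 ^ (n₁ + 1)) = r n₁ := by field_simp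
    rcases hr n₁ with hrn | hrn
    · refine ⟨n₁ + 1, 2 * k₁ + 1, ?_, ?_, ?_⟩ <;> push_cast
      · exact hl.trans hle₁
      · rw [hright]; exact hu
      · rw [hright, hmid]
        rw [hrn] at hcancel ⊢
        rw [pow_succ] at hcancel ⊢
        linarith
    · refine ⟨n₁ + 1, 2 * k₁, ?_, ?_, ?_⟩ <;> push_cast
      · rw [hleft]; exact hl
      · exact hle₂.trans hu
      · rw [hleft, hmid]
        rw [hrn] at hcancel ⊢
        rw [pow_succ] at hcancel ⊢
        linarith

theorem exists_dyadic_Icc_subset {a b : ℝ} (hab : a < b) :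
    ∃ (n : ℕ) (k : ℤ), a ≤ (k : ℝ) / 2 ^ n ∧ ((k : ℝ) + 1) / 2 ^ n ≤ b := by
  obtain ⟨n, hn⟩ := pow_unbounded_of_one_lt (2 / (b - a)) (one_lt_two : (1 : ℝ) < 2)
  have hpow : (0 : ℝ) < 2 ^ n := by positivity
  rw [div_lt_iff₀ (sub_pos.2 hab)] at hn
  refine ⟨n, ⌈2 ^ n * a⌉, ?_, ?_⟩
  · rw [le_div_iff₀ hpow, mul_comm]
    exact Int.le_ceil _
  · rw [div_le_iff₀ hpow]
    have := Int.ceil_lt_add_one (2 ^ n * a)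
    linarith

theorem not_monotoneOn_takagi {r : ℕ → ℝ} (hr : ∀ n, r n = 1 ∨ r n = -1) {a b : ℝ}
    (hab : a < b) : ¬ MonotoneOn (takagi r) (Set.Icc a b) := by
  intro hmono
  obtain ⟨n, k, hk1, hk2⟩ := exists_dyadic_Icc_subset hab
  obtain ⟨N, hN⟩ := exists_nat_gt (2 ^ n * (takagi r ((k + 1) / 2 ^ n) - takagi r (k / 2 ^ n)))
  obtain ⟨n', k', hl, hu, h⟩ := exists_dyadic_slope_eq_sub hr N n k
  have hle : (k' : ℝ) / 2 ^ n' ≤ (k' + 1) / 2 ^ n' := by gcongr; linarith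
  have := hmono ⟨hk1.trans hl, hle.trans (hu.trans hk2)⟩
    ⟨(hk1.trans hl).trans hle, hu.trans hk2⟩ hle
  have : 0 ≤ 2 ^ n' * (takagi r ((k' + 1) / 2 ^ n') - takagi r (k' / 2 ^ n')) :=
    mul_nonneg (by positivity) (sub_nonneg.2 this)
  linarith

/-- The values that `f` crosses upwards exactly once on `[a, b]`. -/
def upcrossingValues (f : ℝ → ℝ) (a b : ℝ) : Set ℝ :=
  {y | ∃ x ∈ Set.Icc a b, f x = y ∧ (∀ t ∈ Set.Ico a x, f t < y) ∧ ∀ t ∈ Set.Ioc x b, y < f t}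

theorem isNowhereDense_upcrossingValues {f : ℝ → ℝ}
    (hf : ∀ a b, a < b → ¬ MonotoneOn f (Set.Icc a b)) (a b : ℝ) :
    IsNowhereDense (upcrossingValues f a b) := by
  by_contra hne
  obtain ⟨y₀, hy₀⟩ := Set.nonempty_iff_ne_empty.2 hne
  obtain ⟨p, q, hpq, hsub⟩ := mem_nhds_iff_exists_Ioo_subset.1 (mem_interior_iff_mem_nhds.1 hy₀)
  have hdense : ∀ c d, p ≤ c → c < d → d ≤ q → ∃ y ∈ upcrossingValues f a b, c < y ∧ y < d := by
    intro c d hc hcd hd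
    obtain ⟨e, hce, hed⟩ := exists_between hcd
    obtain ⟨y, hy, hyA⟩ := mem_closure_iff.1 (hsub ⟨hc.trans_lt hce, hed.trans_le hd⟩)
      (Set.Ioo c d) isOpen_Ioo ⟨hce, hed⟩
    exact ⟨y, hyA, hy⟩
  obtain ⟨c, ⟨u, hu, hfu, hcl, hcr⟩, hpc, hcy⟩ := hdense p y₀ le_rfl hpq.1 hpq.2.le
  obtain ⟨d, ⟨v, hv, hfv, hdl, hdr⟩, hyd, hdq⟩ := hdense y₀ q hpq.1.le hpq.2 le_rfl
  have huv : u < v := by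
    by_contra! h
    rcases h.eq_or_lt with rfl | h
    · linarith
    · linarith [hcl v ⟨hv.1, h⟩]
  refine hf u v huv fun s hs t ht hst => ?_
  by_contra! hlt
  have hct : c ≤ f t := by
    rcases ht.1.eq_or_lt with h | h
    · rw [← h, hfu]
    · exact (hcr t ⟨h, ht.2.trans hv.2⟩).le
  have hsd : f s ≤ d := by
    rcases hs.2.eq_or_lt with h | h
    · rw [h, hfv]
    · exact (hdl s ⟨hu.1.trans hs.1, h⟩).le
  obtain ⟨y, ⟨x, hx, hfx, hl, hr⟩, hty, hys⟩ :=
    hdense (f t) (f s) (hpc.le.trans hct) hlt (hsd.trans hdq.le)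
  have hxs : x ≤ s := by
    by_contra! h
    exact hys.not_gt (hl s ⟨hu.1.trans hs.1, h⟩)
  have htx : t ≤ x := by
    by_contra! h
    exact hty.not_gt (hr t ⟨h, ht.2.trans hv.2⟩)
  have : s = t := le_antisymm hst (htx.trans hxs)
  exact hlt.ne (by rw [this])

theorem Set.Subsingleton.isMeagre_real {s : Set ℝ} (hs : s.Subsingleton) : IsMeagre s := by
  rcases hs.eq_empty_or_singleton with rfl | ⟨x, rfl⟩
  · exact IsMeagre.empty
  · exact IsNowhereDense.isMeagre (isClosed_singleton.isNowhereDense_iff.2 (interior_singleton x))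

theorem IsMeagre.preimage_val_Icc {s : Set ℝ} (hs : IsMeagre s) {m M : ℝ} (hmM : m < M) :
    IsMeagre (Subtype.val ⁻¹' s : Set (Set.Icc m M)) := by
  rw [isMeagre_iff_countable_union_isNowhereDense] at hs ⊢
  obtain ⟨S, hS, hc, hsub⟩ := hs
  refine ⟨Set.preimage Subtype.val '' S, ?_, hc.image _, ?_⟩
  · rintro _ ⟨t, ht, rfl⟩
    have hd : Dense (closure t)ᶜ := interior_eq_empty_iff_dense_compl.1 (hS t ht)
    have hcl : IsClosed (Subtype.val ⁻¹' closure t : Set (Set.Icc m M)) :=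
      isClosed_closure.preimage continuous_subtype_val
    refine IsNowhereDense.mono (Set.preimage_mono subset_closure) (hcl.isNowhereDense_iff.2 ?_)
    rw [Set.eq_empty_iff_forall_notMem]
    intro x hx
    obtain ⟨U, hUsub, hU, hxU⟩ := mem_interior.1 hx
    obtain ⟨O, hO, rfl⟩ := isOpen_induced_iff.1 hU
    have hxcl : (x : ℝ) ∈ closure (Set.Ioo m M) := by
      rw [closure_Ioo hmM.ne]
      exact x.2
    obtain ⟨z, hz⟩ := mem_closure_iff.1 hxcl O hO hxU
    obtain ⟨w, hw, hwt⟩ := hd.inter_open_nonempty _ (hO.inter isOpen_Ioo) ⟨z, hz⟩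
    exact hwt (hUsub (a := ⟨w, Set.Ioo_subset_Icc_self hw.2⟩) hw.1)
  · rw [Set.sUnion_image, ← Set.preimage_sUnion]
    exact Set.preimage_mono hsub

/-- The values that `f` attains exactly once on `[a, b]`, at an interior point. -/
def uniqueValues (f : ℝ → ℝ) (a b : ℝ) : Set ℝ :=
  {y | ∃ x ∈ Set.Ioo a b, f x = y ∧ ∀ t ∈ Set.Icc a b, f t = y → t = x}

theorem forall_lt_or_forall_gt_of_isPreconnected {f : ℝ → ℝ} (hf : Continuous f) {s : Set ℝ}
    (hs : IsPreconnected s) {y : ℝ} (hy : ∀ t ∈ s, f t ≠ y) :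
    (∀ t ∈ s, f t < y) ∨ ∀ t ∈ s, y < f t := by
  by_contra! h
  obtain ⟨⟨t, ht, hyt⟩, u, hu, huy⟩ := h
  obtain ⟨v, hv, hfv⟩ := hs.intermediate_value hu ht hf.continuousOn ⟨huy, hyt⟩
  exact hy v hv hfv

theorem isMeagre_uniqueValues {f : ℝ → ℝ} (hf : Continuous f)
    (hmono : ∀ a b, a < b → ¬ MonotoneOn f (Set.Icc a b))
    (hanti : ∀ a b, a < b → ¬ MonotoneOn (-f) (Set.Icc a b)) (a b : ℝ) :
    IsMeagre (uniqueValues f a b) := by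
  have hneg : IsMeagre (Neg.neg ⁻¹' upcrossingValues (-f) a b) :=
    (isNowhereDense_upcrossingValues hanti a b).isMeagre.preimage_of_isOpenMap
      continuous_neg (Homeomorph.neg ℝ).isOpenMap
  have hmax : IsMeagre {y | IsGreatest (f '' Set.Icc a b) y} :=
    Set.Subsingleton.isMeagre_real fun _ h₁ _ h₂ => h₁.unique h₂
  have hmin : IsMeagre {y | IsLeast (f '' Set.Icc a b) y} :=
    Set.Subsingleton.isMeagre_real fun _ h₁ _ h₂ => h₁.unique h₂
  refine IsMeagre.mono ?_ (((isNowhereDense_upcrossingValues hmono a b).isMeagre.union hneg).union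
    (hmax.union hmin))
  rintro _ ⟨x, hx, rfl, huniq⟩
  have hxI := Set.Ioo_subset_Icc_self hx
  have hl := forall_lt_or_forall_gt_of_isPreconnected hf (isPreconnected_Ico (a := a) (b := x))
    (y := f x) fun t ht h => ht.2.ne (huniq t ⟨ht.1, (ht.2.trans hx.2).le⟩ h)
  have hr := forall_lt_or_forall_gt_of_isPreconnected hf (isPreconnected_Ioc (a := x) (b := b))
    (y := f x) fun t ht h => ht.1.ne' (huniq t ⟨(hx.1.trans ht.1).le, ht.2⟩ h)
  rcases hl with hl | hl <;> rcases hr with hr | hr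
  · refine Or.inr (Or.inl ⟨⟨x, hxI, rfl⟩, ?_⟩)
    rintro _ ⟨t, ht, rfl⟩
    rcases lt_trichotomy t x with h | rfl | h
    · exact (hl t ⟨ht.1, h⟩).le
    · exact le_rfl
    · exact (hr t ⟨h, ht.2⟩).le
  · exact Or.inl (Or.inl ⟨x, hxI, rfl, hl, hr⟩)
  · exact Or.inl (Or.inr ⟨x, hxI, rfl, fun t ht => neg_lt_neg (hl t ht),
      fun t ht => neg_lt_neg (hr t ht)⟩)
  · refine Or.inr (Or.inr ⟨⟨x, hxI, rfl⟩, ?_⟩)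
    rintro _ ⟨t, ht, rfl⟩
    rcases lt_trichotomy t x with h | rfl | h
    · exact (hl t ⟨ht.1, h⟩).le
    · exact le_rfl
    · exact (hr t ⟨h, ht.2⟩).le

theorem perfect_levelSet {f : ℝ → ℝ} (hf : Continuous f) {c d y : ℝ} (hc : f c ≠ y)
    (hd : f d ≠ y) (hy : ∀ p q : ℚ, y ∉ uniqueValues f p q) :
    Perfect {x : ℝ | x ∈ Set.Icc c d ∧ f x = y} := by
  refine ⟨isClosed_Icc.inter (isClosed_singleton.preimage hf), ?_⟩
  rintro x ⟨hx, hfx⟩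
  rw [accPt_iff_nhds]
  by_contra! h
  obtain ⟨U, hU, hUx⟩ := h
  have hcx : c < x := lt_of_le_of_ne hx.1 fun h => hc (h ▸ hfx)
  have hxd : x < d := lt_of_le_of_ne hx.2 fun h => hd (h ▸ hfx)
  obtain ⟨a, b, hxab, hab⟩ :=
    mem_nhds_iff_exists_Ioo_subset.1 (Filter.inter_mem hU (Ioo_mem_nhds hcx hxd))
  obtain ⟨p, hap, hpx⟩ := exists_rat_btwn hxab.1
  obtain ⟨q, hxq, hqb⟩ := exists_rat_btwn hxab.2
  refine hy p q ⟨x, ⟨hpx, hxq⟩, hfx, fun t ht hft => ?_⟩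
  have htab := hab ⟨hap.trans_le ht.1, ht.2.trans_lt hqb⟩
  exact hUx t ⟨htab.1, Set.Ioo_subset_Icc_self htab.2, hft⟩

/-- The set of ordinates `y` whose level set `L_f(y)` is a nonempty perfect set
(hence uncountable) is residual (comeagre) in the range `[m(f), M(f)]` of `f`. -/
theorem perfect_level_sets_residual (r : ℕ → ℝ) (hr : ∀ n, r n = 1 ∨ r n = -1)
    (M m : ℝ) (hM : IsGreatest (takagi r '' Set.Icc 0 1) M)
    (hm : IsLeast (takagi r '' Set.Icc 0 1) m) :
    (Subtype.val ⁻¹' {y : ℝ |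
        Perfect {x : ℝ | x ∈ Set.Icc (0 : ℝ) 1 ∧ takagi r x = y} ∧
        {x : ℝ | x ∈ Set.Icc (0 : ℝ) 1 ∧ takagi r x = y}.Nonempty} :
      Set (Set.Icc m M)) ∈ residual (Set.Icc m M) := by
  have hcont := continuous_takagi hr
  have hneg : ∀ n, (-r) n = 1 ∨ (-r) n = -1 := fun n => by
    rcases hr n with h | h <;> simp [h]
  have hmono : ∀ a b, a < b → ¬ MonotoneOn (takagi r) (Set.Icc a b) :=
    fun _ _ => not_monotoneOn_takagi hr
  have hanti : ∀ a b, a < b → ¬ MonotoneOn (-takagi r) (Set.Icc a b) := fun _ _ h => by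
    rw [← takagi_neg]
    exact not_monotoneOn_takagi hneg h
  have hmM : m < M := by
    by_contra! h
    refine hmono 0 1 one_pos fun s hs t ht _ => ?_
    exact (hM.2 ⟨s, hs, rfl⟩).trans (h.trans (hm.2 ⟨t, ht, rfl⟩))
  have h0 : takagi r 0 = 0 := by simpa using takagi_dyadic r 0 0
  have h1 : takagi r 1 = 0 := by simpa using takagi_dyadic r 0 1
  have hbad : IsMeagre ({0} ∪ ⋃ p : ℚ, ⋃ q : ℚ, uniqueValues (takagi r) p q) :=
    Set.subsingleton_singleton.isMeagre_real.union <| isMeagre_iUnion fun p =>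
      isMeagre_iUnion fun q => isMeagre_uniqueValues hcont hmono hanti p q
  refine Filter.mem_of_superset (hbad.preimage_val_Icc hmM) fun y hy => ⟨?_, ?_⟩
  · simp only [Set.mem_compl_iff, Set.mem_preimage, Set.mem_union, Set.mem_singleton_iff,
      Set.mem_iUnion, not_or, not_exists] at hy
    exact perfect_levelSet hcont (by rw [h0]; exact Ne.symm hy.1) (by rw [h1]; exact Ne.symm hy.1)
      hy.2
  · obtain ⟨u, hu, hum⟩ := hm.1
    obtain ⟨v, hv, hvM⟩ := hM.1
    obtain ⟨x, hx, hxy⟩ := isPreconnected_Icc.intermediate_value hu hv hcont.continuousOn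
      (by rw [hum, hvM]; exact y.2 : (y : ℝ) ∈ Set.Icc (takagi r u) (takagi r v))
    exact ⟨x, hx, hxy⟩
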